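/- arXiv:math/0410040 — 2 statements merged into one kernel-verified Lean document; each statement's English description precedes it below -/
import Mathlib

section
/- There is no nonzero Hodge class in ∧²V ⊗ ∧²V* ⊗ ∧²V: if an element x of the ℚ-vector space ∧²V ⊗ ∧²V* ⊗ ∧²V is such that its image in ℂ ⊗ (∧²V ⊗ ∧²V* ⊗ ∧²V) lies in the (3,3)-component of the weight-6 Hodge decomposition, then x = 0. (This is Lemma 'plustard1' of the paper: there is no nonzero morphism of Hodge structures from A²₁ to A²₁ ⊗ A²₂.) -/
open scoped TensorProduct

set_option maxHeartbeats 1000000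
set_option synthInstance.maxHeartbeats 400000

noncomputable section

namespace VoisinPaper

/-- The splitting field of a polynomial with roots `lam 0, …, lam (m-1)`, realized as the
subfield of `ℂ` generated by the roots. -/
def splittingFieldOfRoots (m : ℕ) (lam : Fin m → ℂ) : IntermediateField ℚ ℂ :=
  IntermediateField.adjoin ℚ (Set.range lam)

lemma root_mem_splittingFieldOfRoots (m : ℕ) (lam : Fin m → ℂ) (i : Fin m) :
    lam i ∈ splittingFieldOfRoots m lam :=
  IntermediateField.subset_adjoin ℚ _ ⟨i, rfl⟩

/-- Condition (*): the Galois group of the splitting field of the roots over `ℚ` acts on the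
set of roots as the full symmetric group on `m` letters. -/
def galoisActsFully (m : ℕ) (lam : Fin m → ℂ) : Prop :=
  ∀ τ : Equiv.Perm (Fin m),
    ∃ σ : (splittingFieldOfRoots m lam) ≃ₐ[ℚ] (splittingFieldOfRoots m lam),
      ∀ i, (σ ⟨lam i, root_mem_splittingFieldOfRoots m lam i⟩ : ℂ) = lam (τ i)

/-- The canonical map `V → ℂ ⊗_ℚ V`, `v ↦ 1 ⊗ v`. -/
def iotaV (V : Type) [AddCommGroup V] [Module ℚ V] : V →ₗ[ℚ] ℂ ⊗[ℚ] V :=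
  TensorProduct.mk ℚ ℂ V 1

/-- The conjugation of `ℂ ⊗_ℚ V`: the `ℂ`-antilinear involution fixing `1 ⊗ V`. -/
def conjV (V : Type) [AddCommGroup V] [Module ℚ V] : ℂ ⊗[ℚ] V →ₗ[ℚ] ℂ ⊗[ℚ] V :=
  TensorProduct.map ((Complex.conjAe.toLinearMap).restrictScalars ℚ) LinearMap.id

/-- The image `c(W)` of a subspace `W ⊆ ℂ ⊗_ℚ V` under the conjugation. -/
def conjSub (V : Type) [AddCommGroup V] [Module ℚ V] (W : Submodule ℂ (ℂ ⊗[ℚ] V)) :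
    Submodule ℚ (ℂ ⊗[ℚ] V) :=
  Submodule.map (conjV V) (W.restrictScalars ℚ)

/-- The `(p, k-p)` Hodge component of `⋀^k (ℂ ⊗ V)` (sitting inside the exterior algebra of
`ℂ ⊗ V`): the `ℂ`-span of wedge products of `p` elements of `W` and `k - p` elements of
`c(W)`; this is the image of `⋀^p W ⊗ ⋀^{k-p} c(W)` under the wedge product. -/
def hodgeComp (V : Type) [AddCommGroup V] [Module ℚ V] (W : Submodule ℂ (ℂ ⊗[ℚ] V))
    (k p : ℕ) : Submodule ℂ (ExteriorAlgebra ℂ (ℂ ⊗[ℚ] V)) :=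
  Submodule.span ℂ {x | ∃ v : Fin k → ℂ ⊗[ℚ] V,
     (∀ i : Fin k, ((i : ℕ) < p → v i ∈ W) ∧ (p ≤ (i : ℕ) → v i ∈ conjSub V W)) ∧
     x = ExteriorAlgebra.ιMulti ℂ k v}

/-- The natural "complexification" morphism from the exterior algebra of `V` over `ℚ` to the
exterior algebra of `ℂ ⊗ V` over `ℂ`; it identifies `⋀^k_ℚ V` with the rational points of
`⋀^k_ℂ (ℂ ⊗ V)`. -/
def thetaA (V : Type) [AddCommGroup V] [Module ℚ V]
    [Algebra ℚ (ExteriorAlgebra ℂ (ℂ ⊗[ℚ] V))]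
    [IsScalarTower ℚ ℂ (ExteriorAlgebra ℂ (ℂ ⊗[ℚ] V))] :
    ExteriorAlgebra ℚ V →ₐ[ℚ] ExteriorAlgebra ℂ (ℂ ⊗[ℚ] V) :=
  ExteriorAlgebra.lift ℚ
    ⟨((ExteriorAlgebra.ι ℂ (M := ℂ ⊗[ℚ] V)).restrictScalars ℚ) ∘ₗ iotaV V,
      fun _ => ExteriorAlgebra.ι_sq_zero _⟩

/-- The dual of the complexification of `V`. -/
abbrev DualVC (V : Type) [AddCommGroup V] [Module ℚ V] := Module.Dual ℂ (ℂ ⊗[ℚ] V)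

/-- The exterior algebra of the complexification of `V`. -/
abbrev ExtC (V : Type) [AddCommGroup V] [Module ℚ V] := ExteriorAlgebra ℂ (ℂ ⊗[ℚ] V)

/-- The exterior algebra of the dual of the complexification of `V`. -/
abbrev ExtD (V : Type) [AddCommGroup V] [Module ℚ V] := ExteriorAlgebra ℂ (DualVC V)

/-- A `ℂ`-linear functional on `ℂ ⊗ V` is rational if it takes rational values on `1 ⊗ V`;
rational functionals are exactly the complexifications of `ℚ`-linear functionals on `V`. -/
def isRatFunctional (V : Type) [AddCommGroup V] [Module ℚ V] (f : DualVC V) : Prop :=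
  ∀ x : V, ∃ r : ℚ, f (iotaV V x) = (r : ℂ)

/-- The rational points of `⋀²(V*)_ℂ`: the `ℚ`-span of wedges of rational functionals; this
is the image of `⋀² V*` in `⋀²(V*)_ℂ`. -/
def ratDual2 (V : Type) [AddCommGroup V] [Module ℚ V]
    [Module ℚ (ExtD V)] [IsScalarTower ℚ ℂ (ExtD V)] : Submodule ℚ (ExtD V) :=
  Submodule.span ℚ {x | ∃ fg : Fin 2 → DualVC V, (∀ i, isRatFunctional V (fg i)) ∧
    x = ExteriorAlgebra.ιMulti ℂ 2 fg}

/-- The `(p, 2-p)` Hodge component of `⋀²(V*)_ℂ`, for the weight-1 Hodge structure on `V*`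
whose `(1,0)`-part is the annihilator of `W` (so its `(0,1)`-part is the annihilator of
`c(W)`). -/
def dualHodgeComp (V : Type) [AddCommGroup V] [Module ℚ V] (W : Submodule ℂ (ℂ ⊗[ℚ] V))
    (p : ℕ) : Submodule ℂ (ExtD V) :=
  Submodule.span ℂ {x | ∃ fg : Fin 2 → DualVC V,
    (∀ i : Fin 2, ((i : ℕ) < p → ∀ y ∈ W, fg i y = 0) ∧
      (p ≤ (i : ℕ) → ∀ y ∈ conjSub V W, fg i y = 0)) ∧
    x = ExteriorAlgebra.ιMulti ℂ 2 fg}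

section helpers
variable {M : Type*} [AddCommGroup M] [Module ℂ M]

def Dalt (p q : M →ₗ[ℂ] ℂ) : M [⋀^Fin 2]→ₗ[ℂ] ℂ :=
  (Matrix.detRowAlternating (R := ℂ) (n := Fin 2)).compLinearMap (LinearMap.pi ![p, q])

lemma Dalt_apply (p q : M →ₗ[ℂ] ℂ) (v : Fin 2 → M) :
    Dalt p q v = p (v 0) * q (v 1) - q (v 0) * p (v 1) := by
  have : Dalt p q v = Matrix.det (Matrix.of fun a b : Fin 2 => LinearMap.pi ![p, q] (v a) b) := rfl
  rw [this, Matrix.det_fin_two]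
  rfl

def Dfam (p q : M →ₗ[ℂ] ℂ) : ∀ i : ℕ, M [⋀^Fin i]→ₗ[ℂ] ℂ
  | 2 => Dalt p q
  | _ => 0

def DD (p q : M →ₗ[ℂ] ℂ) : ExteriorAlgebra ℂ M →ₗ[ℂ] ℂ :=
  ExteriorAlgebra.liftAlternating (Dfam p q)

lemma DD_apply (p q : M →ₗ[ℂ] ℂ) (v : Fin 2 → M) :
    DD p q (ExteriorAlgebra.ιMulti ℂ 2 v) = p (v 0) * q (v 1) - q (v 0) * p (v 1) := by
  rw [DD, ExteriorAlgebra.liftAlternating_apply_ιMulti]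
  exact Dalt_apply p q v

lemma iM2 (v : Fin 2 → M) : ExteriorAlgebra.ιMulti ℂ 2 v =
    ExteriorAlgebra.ι ℂ (v 0) * ExteriorAlgebra.ι ℂ (v 1) := by
  simp [ExteriorAlgebra.ιMulti_apply, Matrix.vecTail]

lemma recon {I : Type*} [Fintype I] (p : I → M →ₗ[ℂ] ℂ) (b : I → M) (c : I → ℂ)
    (h : ∀ x, ∑ i, (c i * p i x) • b i = x) (v : Fin 2 → M) :
    ∑ i, ∑ j, (c i * c j * DD (p i) (p j) (ExteriorAlgebra.ιMulti ℂ 2 v)) •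
      (ExteriorAlgebra.ι ℂ (b i) * ExteriorAlgebra.ι ℂ (b j)) =
      (2 : ℂ) • ExteriorAlgebra.ιMulti ℂ 2 v := by
  have key : ∀ x y : M, ∑ i, ∑ j, (c i * c j * (p i x * p j y)) •
      (ExteriorAlgebra.ι ℂ (b i) * ExteriorAlgebra.ι ℂ (b j)) =
      ExteriorAlgebra.ι ℂ x * ExteriorAlgebra.ι ℂ y := by
    intro x y
    conv_rhs => rw [← h x, ← h y]
    rw [map_sum, map_sum, Finset.sum_mul_sum]
    refine Finset.sum_congr rfl fun i _ => Finset.sum_congr rfl fun j _ => ?_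
    rw [map_smul, map_smul, smul_mul_smul_comm]
    congr 1; ring
  have hs : ExteriorAlgebra.ι ℂ (v 1) * ExteriorAlgebra.ι ℂ (v 0) =
      - (ExteriorAlgebra.ι ℂ (v 0) * ExteriorAlgebra.ι ℂ (v 1)) :=
    eq_neg_of_add_eq_zero_left (ExteriorAlgebra.ι_add_mul_swap _ _)
  have e : (2 : ℂ) • ExteriorAlgebra.ιMulti ℂ 2 v =
    ExteriorAlgebra.ι ℂ (v 0) * ExteriorAlgebra.ι ℂ (v 1) -
      ExteriorAlgebra.ι ℂ (v 1) * ExteriorAlgebra.ι ℂ (v 0) := by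
    rw [iM2 v, hs, two_smul, sub_neg_eq_add]
  rw [e, ← key, ← key, ← Finset.sum_sub_distrib]
  refine Finset.sum_congr rfl fun i _ => ?_
  rw [← Finset.sum_sub_distrib]
  refine Finset.sum_congr rfl fun j _ => ?_
  rw [← sub_smul, DD_apply]
  congr 1; ring

lemma comb (m : ℕ) (hm : 3 ≤ m) (E : Fin m → ℤ) (hE : ∀ i, E i = 0 ∨ E i = 1)
    (i : Fin 6 → Fin m)
    (h : ∀ τ : Equiv.Perm (Fin m), E (τ (i 0)) + E (τ (i 1)) - E (τ (i 2)) - E (τ (i 3))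
      + E (τ (i 4)) + E (τ (i 5)) = 1) : False := by
  classical
  set w : Fin m → ℤ := fun j => (if i 0 = j then 1 else 0) + (if i 1 = j then 1 else 0)
    - (if i 2 = j then 1 else 0) - (if i 3 = j then 1 else 0) + (if i 4 = j then 1 else 0)
    + (if i 5 = j then 1 else 0) with hw
  have hsum : ∀ g : Fin m → ℤ, ∑ j, w j * g j =
      g (i 0) + g (i 1) - g (i 2) - g (i 3) + g (i 4) + g (i 5) := by
    intro g
    simp [hw, add_mul, sub_mul, Finset.sum_add_distrib, Finset.sum_sub_distrib]
  have h1 : ∃ a, E a = 1 := by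
    by_contra hc
    push Not at hc
    have h0 : ∀ a, E a = 0 := fun a => (hE a).resolve_right (hc a)
    have := h 1
    simp [h0] at this
  have h2 : ∃ a, E a = 0 := by
    by_contra hc
    push Not at hc
    have h0 : ∀ a, E a = 1 := fun a => (hE a).resolve_left (hc a)
    have := h 1
    simp [h0] at this
  obtain ⟨a, ha⟩ := h1
  obtain ⟨b, hb⟩ := h2
  have hab : a ≠ b := by rintro rfl; omega
  have hτ : ∀ τ : Equiv.Perm (Fin m), ∑ j, w j * E (τ j) = 1 := fun τ => by
    rw [hsum (fun j => E (τ j))]; exact h τ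
  have hconst : ∀ j k, w j = w k := by
    intro j k
    by_cases hjk : j = k
    · rw [hjk]
    set τ : Equiv.Perm (Fin m) := Equiv.swap (Equiv.swap j a k) b * Equiv.swap j a with hτd
    have hka : a ≠ Equiv.swap j a k := by
      intro hh
      have := congrArg (Equiv.swap j a) hh
      simp at this
      exact hjk this
    have hj : τ j = a := by
      simp [hτd, Equiv.swap_apply_of_ne_of_ne hka hab]
    have hk : τ k = b := by simp [hτd]
    have e1 := hτ τ
    have e2 := hτ (τ * Equiv.swap j k)
    have e3 : ∑ l, w l * (E (τ l) - E ((τ * Equiv.swap j k) l)) = 0 := by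
      simp only [mul_sub, Finset.sum_sub_distrib, e1, e2, sub_self]
    rw [Finset.sum_eq_add j k hjk] at e3
    · simp [hj, hk, ha, hb] at e3; omega
    · intro l _ ⟨hl1, hl2⟩
      simp [Equiv.swap_apply_of_ne_of_ne hl1 hl2]
    · simp
    · simp
  have ht := hsum (fun _ => 1)
  have hcc : ∀ j, w j = w a := fun j => hconst j a
  simp only [hcc, mul_one, Finset.sum_const, Finset.card_univ, Fintype.card_fin, nsmul_eq_mul] at ht
  have hm' : (3 : ℤ) ≤ m := by exact_mod_cast hm
  have : (m : ℤ) ∣ 2 := ⟨w a, by linarith⟩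
  have := Int.le_of_dvd (by norm_num) this
  omega

/-- Divided difference of the polynomial `F`, evaluated at `(T, z)`. -/
def GG (F : Polynomial ℂ) (T : Module.End ℂ M) (z : ℂ) : Module.End ℂ M :=
  ∑ m ∈ Finset.range (F.natDegree + 1), F.coeff m •
    ∑ a ∈ Finset.range m, T ^ a * (algebraMap ℂ (Module.End ℂ M) z) ^ (m - 1 - a)

lemma GG_mul (F : Polynomial ℂ) (T : Module.End ℂ M) (z : ℂ)
    (hT : Polynomial.aeval T F = 0) (hz : F.eval z = 0) :
    (T - algebraMap ℂ (Module.End ℂ M) z) * GG F T z = 0 := by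
  have hc : Commute T (algebraMap ℂ (Module.End ℂ M) z) := (Algebra.commutes z T).symm
  have h2 : Polynomial.aeval (algebraMap ℂ (Module.End ℂ M) z) F = 0 := by
    rw [Polynomial.aeval_algebraMap_apply]
    simp [Polynomial.aeval_def, Polynomial.eval₂_eq_eval_map, hz]
  rw [GG, Finset.mul_sum]
  simp only [mul_smul_comm, hc.mul_geom_sum₂, smul_sub]
  rw [Finset.sum_sub_distrib, ← Polynomial.aeval_eq_sum_range, ← Polynomial.aeval_eq_sum_range,
    hT, h2, sub_zero]

lemma GG_comm (F : Polynomial ℂ) (T : Module.End ℂ M) (z : ℂ) : Commute T (GG F T z) := by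
  have hc : Commute T (algebraMap ℂ (Module.End ℂ M) z) := (Algebra.commutes z T).symm
  refine Commute.sum_right _ _ _ fun m _ => Commute.smul_right (Commute.sum_right _ _ _ fun a _ => ?_) _
  exact ((Commute.refl T).pow_right a).mul_right (hc.pow_right _)

lemma GG_eig (F : Polynomial ℂ) (T : Module.End ℂ M) (z : ℂ) (x : M) (hx : T x = z • x) :
    GG F T z x = (F.derivative.eval z) • x := by
  have hp : ∀ a : ℕ, (T ^ a) x = z ^ a • x := by
    intro a
    induction a with
    | zero => simp
    | succ a ih => rw [pow_succ', Module.End.mul_apply, ih, map_smul, hx, smul_smul, pow_succ]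
  have : ∀ m : ℕ, (∑ a ∈ Finset.range m, T ^ a * (algebraMap ℂ (Module.End ℂ M) z) ^ (m - 1 - a)) x
      = ((m : ℂ) * z ^ (m - 1)) • x := by
    intro m
    rw [LinearMap.sum_apply]
    rw [Finset.sum_congr rfl (g := fun _ => z ^ (m - 1) • x)]
    · simp [← Nat.cast_smul_eq_nsmul ℂ, smul_smul]
    · intro a ha
      rw [Finset.mem_range] at ha
      rw [Module.End.mul_apply, ← map_pow, Module.algebraMap_end_apply, map_smul, hp, smul_smul,
        ← pow_add]
      congr 2; omega
  rw [GG, LinearMap.sum_apply, Polynomial.derivative_eval, Polynomial.sum_over_range _ (by simp),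
    Finset.sum_smul]
  refine Finset.sum_congr rfl fun m _ => ?_
  rw [LinearMap.smul_apply, this, smul_smul, mul_assoc]

lemma GG_mem (F : Polynomial ℂ) (T : Module.End ℂ M) (z : ℂ) (W : Submodule ℂ M)
    (hW : ∀ x ∈ W, T x ∈ W) (x : M) (hx : x ∈ W) : GG F T z x ∈ W := by
  have hp : ∀ a : ℕ, ∀ x ∈ W, (T ^ a) x ∈ W := by
    intro a
    induction a with
    | zero => simp
    | succ a ih => intro x hx; rw [pow_succ', Module.End.mul_apply]; exact hW _ (ih x hx)
  rw [GG, LinearMap.sum_apply]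
  refine W.sum_mem fun m _ => ?_
  rw [LinearMap.smul_apply, LinearMap.sum_apply]
  refine W.smul_mem _ (W.sum_mem fun a _ => ?_)
  rw [Module.End.mul_apply, ← map_pow, Module.algebraMap_end_apply]
  exact hp _ _ (W.smul_mem _ hx)

lemma deriv_ne (F : Polynomial ℂ) (m : ℕ) (hF : F.natDegree = m) (h0 : F ≠ 0)
    (lam : Fin m → ℂ) (hinj : Function.Injective lam) (hr : ∀ i, F.eval (lam i) = 0) (i : Fin m) :
    F.derivative.eval (lam i) ≠ 0 := by
  intro hd
  have h1 := (Polynomial.one_lt_rootMultiplicity_iff_isRoot h0 (t := lam i)).2 ⟨hr i, hd⟩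
  rw [← Polynomial.count_roots] at h1
  have hle : Finset.univ.val.map lam ≤ F.roots := by
    rw [Multiset.le_iff_subset (Multiset.Nodup.map hinj Finset.univ.nodup)]
    intro z hz
    obtain ⟨j, -, rfl⟩ := Multiset.mem_map.1 hz
    exact (Polynomial.mem_roots h0).2 (hr j)
  have he := Multiset.eq_of_le_of_card_le hle (by
    simpa [hF] using F.card_roots')
  rw [← he] at h1
  have := Multiset.nodup_iff_count_le_one.1 (Multiset.Nodup.map hinj Finset.univ.nodup) (lam i)
  omega

end helpers
section setup
variable (V : Type) [AddCommGroup V] [Module ℚ V]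

lemma conjV_smul (z : ℂ) (x : ℂ ⊗[ℚ] V) :
    conjV V (z • x) = (starRingEnd ℂ z) • conjV V x := by
  induction x using TensorProduct.induction_on with
  | zero => simp
  | tmul a v => simp [conjV, TensorProduct.smul_tmul']
  | add x y hx hy => rw [smul_add, map_add, hx, hy, map_add, smul_add]

lemma conjV_comm (φ : V →ₗ[ℚ] V) (x : ℂ ⊗[ℚ] V) :
    LinearMap.baseChange ℂ φ (conjV V x) = conjV V (LinearMap.baseChange ℂ φ x) := by
  induction x using TensorProduct.induction_on with
  | zero => simp
  | tmul a v => simp [conjV]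
  | add x y hx hy => rw [map_add, map_add, hx, hy, map_add, map_add]

def conjSubC (W : Submodule ℂ (ℂ ⊗[ℚ] V)) : Submodule ℂ (ℂ ⊗[ℚ] V) where
  carrier := conjSub V W
  add_mem' := fun h1 h2 => (conjSub V W).add_mem h1 h2
  zero_mem' := (conjSub V W).zero_mem
  smul_mem' := by
    rintro z _ ⟨x, hx, rfl⟩
    refine ⟨(starRingEnd ℂ z) • x, W.smul_mem _ hx, ?_⟩
    rw [conjV_smul]; simp

lemma mem_conjSubC (W : Submodule ℂ (ℂ ⊗[ℚ] V)) (x) : x ∈ conjSubC V W ↔ x ∈ conjSub V W :=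
  Iff.rfl

lemma conjSubC_inv (φ : V →ₗ[ℚ] V) (W : Submodule ℂ (ℂ ⊗[ℚ] V))
    (hWinv : ∀ x ∈ W, LinearMap.baseChange ℂ φ x ∈ W) :
    ∀ x ∈ conjSubC V W, LinearMap.baseChange ℂ φ x ∈ conjSubC V W := by
  rintro _ ⟨x, hx, rfl⟩
  exact ⟨_, hWinv x hx, (conjV_comm V φ x).symm⟩

lemma GG_rat (f : Polynomial ℚ) (φ : V →ₗ[ℚ] V) (ψ : DualVC V) (hψ : isRatFunctional V ψ)
    (v : V) : ∃ P : Polynomial ℚ, ∀ z : ℂ,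
      ψ (GG (f.map (algebraMap ℚ ℂ)) (LinearMap.baseChange ℂ φ) z (iotaV V v)) =
        Polynomial.aeval z P := by
  have hp : ∀ a : ℕ, ((LinearMap.baseChange ℂ φ) ^ a) (iotaV V v) = iotaV V ((φ ^ a) v) := by
    intro a
    induction a with
    | zero => simp
    | succ a ih =>
      rw [pow_succ', Module.End.mul_apply, ih, pow_succ', Module.End.mul_apply]
      simp [iotaV]
  choose r hr using hψ
  refine ⟨∑ m ∈ Finset.range (f.natDegree + 1), Polynomial.C (f.coeff m) *
    ∑ a ∈ Finset.range m, Polynomial.X ^ (m - 1 - a) * Polynomial.C (r ((φ ^ a) v)), fun z => ?_⟩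
  rw [GG, Polynomial.natDegree_map, LinearMap.sum_apply, map_sum, map_sum]
  refine Finset.sum_congr rfl fun m _ => ?_
  rw [LinearMap.smul_apply, LinearMap.sum_apply, map_smul, map_sum, map_mul, map_sum,
    Polynomial.coeff_map, Polynomial.aeval_C, smul_eq_mul]
  congr 1
  refine Finset.sum_congr rfl fun a _ => ?_
  rw [Module.End.mul_apply, ← map_pow, Module.algebraMap_end_apply, map_smul, map_smul, hp, hr]
  simp only [map_mul, map_pow, Polynomial.aeval_X, Polynomial.aeval_C, smul_eq_mul]
  rfl

lemma exists_rat (y : ℂ ⊗[ℚ] V) (hy : y ≠ 0) :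
    ∃ ψ : DualVC V, isRatFunctional V ψ ∧ ψ y ≠ 0 := by
  let b := Module.Basis.ofVectorSpace ℚ V
  let B := Algebra.TensorProduct.basis ℂ b
  by_contra hc
  push Not at hc
  apply hy
  apply B.ext_elem
  intro j
  have := hc (B.coord j) (fun x => ⟨b.repr x j, by
    simp [B, iotaV, Algebra.TensorProduct.basis_repr_tmul]⟩)
  simpa using this

lemma exists_iota (T : Module.End ℂ (ℂ ⊗[ℚ] V)) (hT : T ≠ 0) : ∃ v, T (iotaV V v) ≠ 0 := by
  by_contra hc
  push Not at hc
  apply hT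
  ext x
  simpa [iotaV] using hc x

lemma gal_mv (m : ℕ) (lam : Fin m → ℂ) (hgal : galoisActsFully m lam) {κ : Type}
    (p : MvPolynomial κ ℚ) (i : κ → Fin m) (τ : Equiv.Perm (Fin m))
    (h : MvPolynomial.aeval (fun k => lam (i k)) p = 0) :
    MvPolynomial.aeval (fun k => lam (τ (i k))) p = 0 := by
  obtain ⟨σ, hσ⟩ := hgal τ
  set K := splittingFieldOfRoots m lam
  let x : κ → K := fun k => ⟨lam (i k), root_mem_splittingFieldOfRoots m lam (i k)⟩
  have h1 : algebraMap K ℂ (MvPolynomial.aeval x p) = 0 := by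
    rw [← MvPolynomial.aeval_algebraMap_apply]; exact h
  have h2 : MvPolynomial.aeval x p = 0 := by
    apply (algebraMap K ℂ).injective; rw [h1, map_zero]
  have h3 : MvPolynomial.aeval (fun k => σ (x k)) p = 0 := by
    have := congrArg σ h2
    rw [map_zero] at this
    rw [← this]
    exact (MvPolynomial.comp_aeval_apply x (σ : K →ₐ[ℚ] K) p).symm
  have h4 := congrArg (algebraMap K ℂ) h3
  rw [← MvPolynomial.aeval_algebraMap_apply, map_zero] at h4
  rw [← h4]
  congr 2
  funext k
  exact (hσ (i k)).symm

lemma gal_poly (m : ℕ) (lam : Fin m → ℂ) (hgal : galoisActsFully m lam)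
    (p : Polynomial ℚ) (i j : Fin m)
    (h : Polynomial.aeval (lam i) p = 0) : Polynomial.aeval (lam j) p = 0 := by
  have e : ∀ z : ℂ, MvPolynomial.aeval (fun _ : Unit => z)
      (Polynomial.aeval (MvPolynomial.X () : MvPolynomial Unit ℚ) p) = Polynomial.aeval z p := by
    intro z
    rw [← Polynomial.aeval_algHom_apply]; simp
  have := gal_mv m lam hgal (Polynomial.aeval (MvPolynomial.X () : MvPolynomial Unit ℚ) p)
    (fun _ => i) (Equiv.swap i j) (by rw [e]; exact h)
  rw [e] at this
  simpa using this

lemma setup_lemma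
    (n : ℕ) (hn : 4 ≤ n) [FiniteDimensional ℚ V]
    (hdim : Module.finrank ℚ V = 2 * n)
    (φ : V →ₗ[ℚ] V)
    (lam : Fin (2 * n) → ℂ) (hinj : Function.Injective lam)
    (hroot : ∀ i, Polynomial.aeval (lam i) (LinearMap.charpoly φ) = 0)
    (hgal : galoisActsFully (2 * n) lam)
    (W : Submodule ℂ (ℂ ⊗[ℚ] V))
    (hWinv : ∀ x ∈ W, LinearMap.baseChange ℂ φ x ∈ W)
    (hWsup : W.restrictScalars ℚ ⊔ conjSub V W = ⊤)
    (hWinf : W.restrictScalars ℚ ⊓ conjSub V W = ⊥) :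
    ∃ (e : Fin (2 * n) → ℂ ⊗[ℚ] V) (u : Fin (2 * n) → DualVC V) (c : Fin (2 * n) → ℂ)
      (E : Fin (2 * n) → ℤ),
      (∀ x, ∑ i, (c i * u i x) • e i = x) ∧
      (∀ v : V, ∃ P : Polynomial ℚ, ∀ i, u i (iotaV V v) = Polynomial.aeval (lam i) P) ∧
      (∀ ψ : DualVC V, isRatFunctional V ψ →
        ∃ P : Polynomial ℚ, ∀ i, ψ (e i) = Polynomial.aeval (lam i) P) ∧
      (∀ i, (E i = 1 ∧ e i ∈ W ∧ ∀ x ∈ conjSub V W, u i x = 0) ∨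
        (E i = 0 ∧ e i ∈ conjSub V W ∧ ∀ x ∈ W, u i x = 0)) := by
  classical
  set T : Module.End ℂ (ℂ ⊗[ℚ] V) := LinearMap.baseChange ℂ φ with hTdef
  set F : Polynomial ℂ := (LinearMap.charpoly φ).map (algebraMap ℚ ℂ) with hFdef
  have hFT : F = LinearMap.charpoly T := (LinearMap.charpoly_baseChange φ ℂ).symm
  have hFr : ∀ i, F.eval (lam i) = 0 := fun i => by
    rw [hFdef, Polynomial.eval_map_algebraMap]; exact hroot i
  have hTF : Polynomial.aeval T F = 0 := by rw [hFT]; exact LinearMap.aeval_self_charpoly T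
  have hF0 : F ≠ 0 := by rw [hFT]; exact (LinearMap.charpoly_monic T).ne_zero
  have hdeg : F.natDegree = 2 * n := by
    rw [hFdef, Polynomial.natDegree_map, LinearMap.charpoly_natDegree, hdim]
  have hder := deriv_ne F (2 * n) hdeg hF0 lam hinj hFr
  let i0 : Fin (2 * n) := ⟨0, by omega⟩
  have : Nonempty (Fin (2 * n)) := ⟨i0⟩
  have hG0 : GG F T (lam i0) ≠ 0 := by
    have : Module.End.HasEigenvalue T (lam i0) := by
      rw [Module.End.hasEigenvalue_iff_isRoot_charpoly, ← hFT]; exact hFr i0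
    obtain ⟨x, hx⟩ := this.exists_hasEigenvector
    intro h0
    have h1 := GG_eig F T (lam i0) x hx.apply_eq_smul
    rw [h0, LinearMap.zero_apply] at h1
    rcases smul_eq_zero.1 h1.symm with h | h
    · exact hder i0 h
    · exact hx.2 h
  obtain ⟨v, hv⟩ := exists_iota V _ hG0
  obtain ⟨ψ, hψ, hψv⟩ := exists_rat V _ hv
  let e : Fin (2 * n) → ℂ ⊗[ℚ] V := fun i => GG F T (lam i) (iotaV V v)
  let u : Fin (2 * n) → DualVC V := fun i => ψ ∘ₗ GG F T (lam i)
  have hψe : ∀ i, ψ (e i) ≠ 0 := by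
    obtain ⟨P, hP⟩ := GG_rat V (LinearMap.charpoly φ) φ ψ hψ v
    intro i hi
    apply hψv
    change ψ (GG F T (lam i) (iotaV V v)) = 0 at hi
    rw [hP] at hi ⊢
    exact gal_poly _ lam hgal P i i0 hi
  have hTG : ∀ i x, T (GG F T (lam i) x) = lam i • GG F T (lam i) x := by
    intro i x
    have := LinearMap.congr_fun (GG_mul F T (lam i) hTF (hFr i)) x
    rw [Module.End.mul_apply, LinearMap.sub_apply, Module.algebraMap_end_apply,
      LinearMap.zero_apply, sub_eq_zero] at this
    exact this
  have he0 : ∀ i, e i ≠ 0 := fun i h => hψe i (by rw [h, map_zero])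
  have hli : LinearIndependent ℂ e :=
    Module.End.eigenvectors_linearIndependent' T lam hinj e fun i =>
      ⟨Module.End.mem_eigenspace_iff.2 (hTG i _), he0 i⟩
  let b := basisOfLinearIndependentOfCardEqFinrank hli (by
    rw [Module.finrank_baseChange, hdim, Fintype.card_fin])
  have hb : ∀ i, b i = e i := fun i => by simp [b]
  have hue : ∀ i j, u i (e j) = if i = j then F.derivative.eval (lam i) * ψ (e i) else 0 := by
    intro i j
    split_ifs with h
    · subst h
      change ψ (GG F T (lam i) (e i)) = _
      rw [GG_eig F T (lam i) (e i) (hTG i _), map_smul, smul_eq_mul]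
    · have h1 : T (GG F T (lam i) (e j)) = lam j • GG F T (lam i) (e j) := by
        have := LinearMap.congr_fun (GG_comm F T (lam i)).eq (e j)
        rw [Module.End.mul_apply, Module.End.mul_apply] at this
        rw [this, hTG j, map_smul]
      rw [hTG] at h1
      have h2 : (lam i - lam j) • GG F T (lam i) (e j) = 0 := by rw [sub_smul, h1, sub_self]
      rcases smul_eq_zero.1 h2 with h3 | h3
      · exact absurd (hinj (sub_eq_zero.1 h3)) h
      · change ψ (GG F T (lam i) (e j)) = 0
        rw [h3, map_zero]
  have hrec : ∀ x, ∑ i, ((F.derivative.eval (lam i) * ψ (e i))⁻¹ * u i x) • e i = x := by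
    intro x
    have hu : ∀ i, u i x = b.repr x i * (F.derivative.eval (lam i) * ψ (e i)) := by
      intro i
      conv_lhs => rw [← b.sum_repr x]
      simp [hb, hue]
    conv_rhs => rw [← b.sum_repr x]
    refine Finset.sum_congr rfl fun i _ => ?_
    rw [hu, hb]
    congr 1
    field_simp [hder i, hψe i]
  have hmem : ∀ (N : Submodule ℂ (ℂ ⊗[ℚ] V)), (∀ x ∈ N, T x ∈ N) →
      ∀ x ∈ N, ∀ i, u i x ≠ 0 → e i ∈ N := by
    intro N hN x hx i hux
    have h1 : GG F T (lam i) x ∈ N := GG_mem F T (lam i) N hN x hx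
    have h2 : GG F T (lam i) x ≠ 0 := fun h => hux (by
      change ψ (GG F T (lam i) x) = 0; rw [h, map_zero])
    -- GG x is a multiple of e i
    have h3 : ∀ j, j ≠ i → u j (GG F T (lam i) x) = 0 := by
      intro j hj
      have h5 : T (GG F T (lam j) (GG F T (lam i) x)) = lam i • GG F T (lam j) (GG F T (lam i) x) := by
        have := LinearMap.congr_fun (GG_comm F T (lam j)).eq (GG F T (lam i) x)
        rw [Module.End.mul_apply, Module.End.mul_apply] at this
        rw [this, hTG i, map_smul]
      rw [hTG] at h5
      have h6 : (lam j - lam i) • GG F T (lam j) (GG F T (lam i) x) = 0 := by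
        rw [sub_smul, h5, sub_self]
      rcases smul_eq_zero.1 h6 with h7 | h7
      · exact absurd (hinj (sub_eq_zero.1 h7)) hj
      · change ψ (GG F T (lam j) (GG F T (lam i) x)) = 0
        rw [h7, map_zero]
    have h4 := hrec (GG F T (lam i) x)
    rw [Finset.sum_eq_single i (fun j _ hj => by rw [h3 j hj, mul_zero, zero_smul])
      (fun h => absurd (Finset.mem_univ i) h)] at h4
    set r := (Polynomial.eval (lam i) (Polynomial.derivative F) * ψ (e i))⁻¹ *
      u i (GG F T (lam i) x)
    have hr : r ≠ 0 := fun h => h2 (by rw [← h4, h, zero_smul])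
    rw [← h4] at h1
    have := N.smul_mem r⁻¹ h1
    rwa [smul_smul, inv_mul_cancel₀ hr, one_smul] at this
  have hdisj : ∀ i, e i ∈ W → e i ∈ conjSub V W → False := by
    intro i h1 h2
    have : e i ∈ W.restrictScalars ℚ ⊓ conjSub V W := ⟨h1, h2⟩
    rw [hWinf] at this
    exact he0 i this
  have hcinv := conjSubC_inv V φ W hWinv
  have hor : ∀ i, e i ∈ W ∨ e i ∈ conjSub V W := by
    intro i
    have : e i ∈ W.restrictScalars ℚ ⊔ conjSub V W := by rw [hWsup]; trivial
    obtain ⟨x, hx, y, hy, hxy⟩ := Submodule.mem_sup.1 this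
    have hne : u i (e i) ≠ 0 := by
      rw [hue, if_pos rfl]; exact mul_ne_zero (hder i) (hψe i)
    rw [← hxy, map_add] at hne
    by_cases h : u i x = 0
    · right
      rw [h, zero_add] at hne
      exact hmem (conjSubC V W) hcinv y hy i hne
    · left; exact hmem W hWinv x hx i h
  refine ⟨e, u, fun i => (F.derivative.eval (lam i) * ψ (e i))⁻¹,
    fun i => if e i ∈ W then 1 else 0, hrec, ?_, ?_, ?_⟩
  · intro v'
    obtain ⟨P, hP⟩ := GG_rat V (LinearMap.charpoly φ) φ ψ hψ v'
    exact ⟨P, fun i => hP (lam i)⟩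
  · intro ψ' hψ'
    obtain ⟨P, hP⟩ := GG_rat V (LinearMap.charpoly φ) φ ψ' hψ' v
    exact ⟨P, fun i => hP (lam i)⟩
  · intro i
    by_cases h : e i ∈ W
    · left
      refine ⟨if_pos h, h, fun x hx => ?_⟩
      by_contra hne
      exact hdisj i h (hmem (conjSubC V W) hcinv x hx i hne)
    · right
      refine ⟨if_neg h, (hor i).resolve_left h, fun x hx => ?_⟩
      by_contra hne
      exact h (hmem W hWinv x hx i hne)

end setup
section final

def trip {A B C : Type} [AddCommGroup A] [Module ℂ A] [AddCommGroup B] [Module ℂ B]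
    [AddCommGroup C] [Module ℂ C] (f : A →ₗ[ℂ] ℂ) (g : B →ₗ[ℂ] ℂ) (h : C →ₗ[ℂ] ℂ) :
    A ⊗[ℂ] (B ⊗[ℂ] C) →ₗ[ℂ] ℂ :=
  LinearMap.mul' ℂ ℂ ∘ₗ TensorProduct.map f (LinearMap.mul' ℂ ℂ ∘ₗ TensorProduct.map g h)

lemma trip_tmul {A B C : Type} [AddCommGroup A] [Module ℂ A] [AddCommGroup B] [Module ℂ B]
    [AddCommGroup C] [Module ℂ C] (f : A →ₗ[ℂ] ℂ) (g : B →ₗ[ℂ] ℂ) (h : C →ₗ[ℂ] ℂ) (a : A) (b : B)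
    (c : C) : trip f g h (a ⊗ₜ[ℂ] (b ⊗ₜ[ℂ] c)) = f a * (g b * h c) := by
  simp [trip]

lemma tmul_sums {A B C : Type} [AddCommGroup A] [Module ℂ A] [AddCommGroup B] [Module ℂ B]
    [AddCommGroup C] [Module ℂ C] {J : Type} [Fintype J] (x y z : J → ℂ) (a : J → A) (b : J → B)
    (c : J → C) : (∑ i, x i • a i) ⊗ₜ[ℂ] ((∑ j, y j • b j) ⊗ₜ[ℂ] (∑ k, z k • c k)) =
    ∑ i, ∑ j, ∑ k, (x i * (y j * z k)) • (a i ⊗ₜ[ℂ] (b j ⊗ₜ[ℂ] c k)) := by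
  rw [TensorProduct.sum_tmul]
  refine Finset.sum_congr rfl fun i _ => ?_
  rw [TensorProduct.sum_tmul, TensorProduct.tmul_sum]
  refine Finset.sum_congr rfl fun j _ => ?_
  rw [TensorProduct.tmul_sum, TensorProduct.tmul_sum]
  refine Finset.sum_congr rfl fun k _ => ?_
  rw [TensorProduct.smul_tmul_smul, TensorProduct.smul_tmul_smul]

/-- polynomial functions with rational coefficients in the roots -/
def SS (m : ℕ) (lam : Fin m → ℂ) : Subalgebra ℚ ((Fin 6 → Fin m) → ℂ) :=
  (MvPolynomial.aeval (fun (k : Fin 6) (i : Fin 6 → Fin m) => lam (i k)) :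
    MvPolynomial (Fin 6) ℚ →ₐ[ℚ] ((Fin 6 → Fin m) → ℂ)).range

lemma SS_var (m : ℕ) (lam : Fin m → ℂ) (k : Fin 6) :
    (fun i : Fin 6 → Fin m => lam (i k)) ∈ SS m lam :=
  ⟨MvPolynomial.X k, by simp⟩

lemma SS_poly (m : ℕ) (lam : Fin m → ℂ) (k : Fin 6) (P : Polynomial ℚ) :
    (fun i : Fin 6 → Fin m => Polynomial.aeval (lam (i k)) P) ∈ SS m lam := by
  have h : (fun i : Fin 6 → Fin m => Polynomial.aeval (lam (i k)) P) =
      Polynomial.aeval (fun i : Fin 6 → Fin m => lam (i k)) P := by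
    funext i
    exact Polynomial.aeval_algHom_apply (Pi.evalAlgHom ℚ (fun _ : Fin 6 → Fin m => ℂ) i)
      (fun i : Fin 6 → Fin m => lam (i k)) P
  rw [h]
  rw [Polynomial.aeval_eq_sum_range]
  exact (SS m lam).sum_mem fun j _ => (SS m lam).smul_mem ((SS m lam).pow_mem (SS_var m lam k) j) _

lemma SS_gal (m : ℕ) (lam : Fin m → ℂ) (hgal : galoisActsFully m lam)
    (g : (Fin 6 → Fin m) → ℂ) (hg : g ∈ SS m lam) (i : Fin 6 → Fin m) (τ : Equiv.Perm (Fin m))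
    (h : g (fun k => τ (i k)) = 0) : g i = 0 := by
  obtain ⟨p, rfl⟩ := hg
  have e : ∀ j : Fin 6 → Fin m, (MvPolynomial.aeval (fun (k : Fin 6) (i : Fin 6 → Fin m) =>
      lam (i k)) p : (Fin 6 → Fin m) → ℂ) j = MvPolynomial.aeval (fun k => lam (j k)) p := by
    intro j
    exact MvPolynomial.comp_aeval_apply (fun (k : Fin 6) (i : Fin 6 → Fin m) => lam (i k))
      (Pi.evalAlgHom ℚ (fun _ : Fin 6 → Fin m => ℂ) j) p
  change (MvPolynomial.aeval (fun (k : Fin 6) (i : Fin 6 → Fin m) =>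
      lam (i k)) p : (Fin 6 → Fin m) → ℂ) _ = 0 at h
  change (MvPolynomial.aeval (fun (k : Fin 6) (i : Fin 6 → Fin m) =>
      lam (i k)) p : (Fin 6 → Fin m) → ℂ) _ = 0
  rw [e] at h ⊢
  have := gal_mv m lam hgal p (fun k => τ (i k)) τ⁻¹ h
  simpa using this

lemma SS_qsmul (m : ℕ) (lam : Fin m → ℂ) {X : Type} [AddCommGroup X] [Module ℚ X]
    (s : Set X) (g : (Fin 6 → Fin m) → X →+ ℂ)
    (h : ∀ x ∈ s, (fun i => g i x) ∈ SS m lam) (x : X) (hx : x ∈ Submodule.span ℚ s) :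
    (fun i => g i x) ∈ SS m lam := by
  induction hx using Submodule.span_induction with
  | mem x hx => exact h x hx
  | zero =>
    simp only [map_zero]
    exact (SS m lam).zero_mem
  | add x y _ _ hx hy =>
    simp only [map_add]
    exact (SS m lam).add_mem hx hy
  | smul q x _ hx =>
    have e : (fun i => g i (q • x)) = q • (fun i => g i x) := by
      funext i
      exact map_rat_smul (g i) q x
    rw [e]
    exact (SS m lam).smul_mem hx q

variable (V : Type) [AddCommGroup V] [Module ℚ V]

lemma thetaA_iM [Algebra ℚ (ExtC V)] [IsScalarTower ℚ ℂ (ExtC V)] (v : Fin 2 → V) :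
    thetaA V (ExteriorAlgebra.ιMulti ℚ 2 v) =
      ExteriorAlgebra.ιMulti ℂ 2 (fun k => iotaV V (v k)) := by
  rw [iM2]
  have : ExteriorAlgebra.ιMulti ℚ 2 v =
      ExteriorAlgebra.ι ℚ (v 0) * ExteriorAlgebra.ι ℚ (v 1) := by
    simp [ExteriorAlgebra.ιMulti_apply, Matrix.vecTail]
  have h : ∀ w : V, thetaA V (ExteriorAlgebra.ι ℚ w) = ExteriorAlgebra.ι ℂ (iotaV V w) :=
    fun w => ExteriorAlgebra.lift_ι_apply _ _ _ _
  rw [this, map_mul, h, h]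

lemma eq_of_span {X Y : Type} [AddCommGroup X] [Module ℚ X]
    [AddCommGroup Y] [Module ℂ Y] (s : Set X) (f g : X →+ Y)
    (h : ∀ x ∈ s, f x = g x) (x : X) (hx : x ∈ Submodule.span ℚ s) : f x = g x := by
  let _ : Module ℚ Y := Module.compHom Y (algebraMap ℚ ℂ)
  induction hx using Submodule.span_induction with
  | mem x hx => exact h x hx
  | zero => simp
  | add x y _ _ hx hy => simp [hx, hy]
  | smul q x _ hx => rw [map_rat_smul f q x, map_rat_smul g q x, hx]

lemma map3 {A B C : Type} [AddCommGroup A] [Module ℂ A] [AddCommGroup B] [Module ℂ B]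
    [AddCommGroup C] [Module ℂ C] {J : Type} [Fintype J]
    (f : J → A →ₗ[ℂ] ℂ) (g : J → B →ₗ[ℂ] ℂ) (h : J → C →ₗ[ℂ] ℂ) (k : J → ℂ)
    (a : J → A) (b : J → B) (c : J → C)
    (RA : A →ₗ[ℂ] A) (RB : B →ₗ[ℂ] B) (RC : C →ₗ[ℂ] C)
    (hA : ∀ x, RA x = ∑ i, (k i * f i x) • a i)
    (hB : ∀ x, RB x = ∑ i, (k i * g i x) • b i)
    (hC : ∀ x, RC x = ∑ i, (k i * h i x) • c i)
    (y : A ⊗[ℂ] (B ⊗[ℂ] C)) :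
    TensorProduct.map RA (TensorProduct.map RB RC) y =
      ∑ i, ∑ j, ∑ l, (k i * (k j * k l) * trip (f i) (g j) (h l) y) •
        (a i ⊗ₜ[ℂ] (b j ⊗ₜ[ℂ] c l)) := by
  induction y using TensorProduct.induction_on with
  | zero => simp
  | add y z hy hz =>
    simp only [map_add, hy, hz, mul_add, add_smul, Finset.sum_add_distrib]
  | tmul x t =>
    induction t using TensorProduct.induction_on with
    | zero => simp
    | add y z hy hz =>
      simp only [TensorProduct.tmul_add, map_add, hy, hz, mul_add, add_smul,
        Finset.sum_add_distrib]
    | tmul y z =>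
      rw [TensorProduct.map_tmul, TensorProduct.map_tmul, hA, hB, hC, tmul_sums]
      refine Finset.sum_congr rfl fun i _ => Finset.sum_congr rfl fun j _ =>
        Finset.sum_congr rfl fun l _ => ?_
      rw [trip_tmul]
      congr 1; ring

/-- The reconstruction operator. -/
def RR {M : Type} [AddCommGroup M] [Module ℂ M] {I : Type} [Fintype I] (p : I → M →ₗ[ℂ] ℂ)
    (b : I → M) (c : I → ℂ) : ExteriorAlgebra ℂ M →ₗ[ℂ] ExteriorAlgebra ℂ M :=
  ∑ ij : I × I, (c ij.1 * c ij.2) • (DD (p ij.1) (p ij.2)).smulRight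
      (ExteriorAlgebra.ι ℂ (b ij.1) * ExteriorAlgebra.ι ℂ (b ij.2))

lemma RR_apply {M : Type} [AddCommGroup M] [Module ℂ M] {I : Type} [Fintype I]
    (p : I → M →ₗ[ℂ] ℂ) (b : I → M) (c : I → ℂ) (x : ExteriorAlgebra ℂ M) :
    RR p b c x = ∑ ij : I × I, (c ij.1 * c ij.2 * DD (p ij.1) (p ij.2) x) •
      (ExteriorAlgebra.ι ℂ (b ij.1) * ExteriorAlgebra.ι ℂ (b ij.2)) := by
  simp [RR, LinearMap.sum_apply, smul_smul]

lemma RR_iM {M : Type} [AddCommGroup M] [Module ℂ M] {I : Type} [Fintype I]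
    (p : I → M →ₗ[ℂ] ℂ) (b : I → M) (c : I → ℂ)
    (h : ∀ x, ∑ i, (c i * p i x) • b i = x) (v : Fin 2 → M) :
    RR p b c (ExteriorAlgebra.ιMulti ℂ 2 v) = (2 : ℂ) • ExteriorAlgebra.ιMulti ℂ 2 v := by
  rw [RR_apply, Fintype.sum_prod_type, recon p b c h v]

lemma hSu_aux [Algebra ℚ (ExtC V)] [IsScalarTower ℚ ℂ (ExtC V)] (m : ℕ) (lam : Fin m → ℂ)
    (u : Fin m → DualVC V)
    (hu : ∀ v : V, ∃ P : Polynomial ℚ, ∀ i, u i (iotaV V v) = Polynomial.aeval (lam i) P)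
    (k l : Fin 6) (a : ExteriorAlgebra ℚ V) (ha : a ∈ ⋀[ℚ]^2 V) :
      (fun i : Fin 6 → Fin m => DD (u (i k)) (u (i l)) (thetaA V a)) ∈ SS m lam := by
  rw [← ExteriorAlgebra.ιMulti_span_fixedDegree] at ha
  refine SS_qsmul m lam _ (fun i => (DD (u (i k)) (u (i l))).toAddMonoidHom.comp
    (thetaA V).toRingHom.toAddMonoidHom) ?_ a ha
  rintro _ ⟨v, rfl⟩
  change (fun i : Fin 6 → Fin m => DD (u (i k)) (u (i l)) (thetaA V (ExteriorAlgebra.ιMulti ℚ 2 v)))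
    ∈ SS m lam
  rw [thetaA_iM]
  simp only [DD_apply]
  obtain ⟨P, hP⟩ := hu (v 0)
  obtain ⟨Q, hQ⟩ := hu (v 1)
  simp only [hP, hQ]
  exact (SS _ lam).sub_mem ((SS _ lam).mul_mem (SS_poly _ lam k P) (SS_poly _ lam l Q))
    ((SS _ lam).mul_mem (SS_poly _ lam l P) (SS_poly _ lam k Q))

lemma hRu_aux [Algebra ℚ (ExtC V)] [IsScalarTower ℚ ℂ (ExtC V)] (m : ℕ)
    (u : Fin m → DualVC V) (e : Fin m → ℂ ⊗[ℚ] V) (c : Fin m → ℂ)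
    (hrec : ∀ x, ∑ i, (c i * u i x) • e i = x)
    (a : ExteriorAlgebra ℚ V) (ha : a ∈ ⋀[ℚ]^2 V) :
    RR u e c (thetaA V a) = (2 : ℂ) • thetaA V a := by
  rw [← ExteriorAlgebra.ιMulti_span_fixedDegree] at ha
  refine eq_of_span _ ((RR u e c).toAddMonoidHom.comp (thetaA V).toRingHom.toAddMonoidHom)
    ((((2 : ℂ) • LinearMap.id : ExtC V →ₗ[ℂ] ExtC V)).toAddMonoidHom.comp
      (thetaA V).toRingHom.toAddMonoidHom) ?_ a ha
  rintro _ ⟨v, rfl⟩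
  change RR u e c (thetaA V (ExteriorAlgebra.ιMulti ℚ 2 v)) =
    (2 : ℂ) • (thetaA V (ExteriorAlgebra.ιMulti ℚ 2 v))
  rw [thetaA_iM]
  exact RR_iM u e c hrec _

end final

/-- Under condition (*) (`n ≥ 4`), there is no nonzero Hodge class in
`⋀²V ⊗ ⋀²V* ⊗ ⋀²V`: if an element of the rational subspace of
`⋀²V_ℂ ⊗ ⋀²V*_ℂ ⊗ ⋀²V_ℂ` lies in the `(3,3)`-component of the weight-6 Hodge
decomposition, then it is zero. -/
theorem no_nonzero_hodge_class_in_triple_tensor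
    (n : ℕ) (hn : 4 ≤ n)
    (V : Type) [AddCommGroup V] [Module ℚ V] [FiniteDimensional ℚ V]
    (hdim : Module.finrank ℚ V = 2 * n)
    (φ : V →ₗ[ℚ] V)
    (lam : Fin (2 * n) → ℂ) (hinj : Function.Injective lam)
    (hroot : ∀ i, Polynomial.aeval (lam i) (LinearMap.charpoly φ) = 0)
    (hgal : galoisActsFully (2 * n) lam)
    (W : Submodule ℂ (ℂ ⊗[ℚ] V))
    (hWdim : Module.finrank ℂ W = n)
    (hWinv : ∀ x ∈ W, LinearMap.baseChange ℂ φ x ∈ W)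
    (hWsup : W.restrictScalars ℚ ⊔ conjSub V W = ⊤)
    (hWinf : W.restrictScalars ℚ ⊓ conjSub V W = ⊥)
    [Algebra ℚ (ExtC V)] [IsScalarTower ℚ ℂ (ExtC V)]
    [Module ℚ (ExtD V)] [IsScalarTower ℚ ℂ (ExtD V)]
    [Module ℚ (ExtC V ⊗[ℂ] (ExtD V ⊗[ℂ] ExtC V))]
    [IsScalarTower ℚ ℂ (ExtC V ⊗[ℂ] (ExtD V ⊗[ℂ] ExtC V))] :
    ∀ y : ExtC V ⊗[ℂ] (ExtD V ⊗[ℂ] ExtC V),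
      y ∈ Submodule.span ℚ {t : ExtC V ⊗[ℂ] (ExtD V ⊗[ℂ] ExtC V) |
          ∃ (a b : ExteriorAlgebra ℚ V) (d : ExtD V),
            a ∈ ⋀[ℚ]^2 V ∧ b ∈ ⋀[ℚ]^2 V ∧ d ∈ ratDual2 V ∧
            t = thetaA V a ⊗ₜ[ℂ] (d ⊗ₜ[ℂ] thetaA V b)} →
      y ∈ Submodule.span ℂ {t : ExtC V ⊗[ℂ] (ExtD V ⊗[ℂ] ExtC V) |
          ∃ p₁ p₂ p₃ : ℕ, p₁ ≤ 2 ∧ p₂ ≤ 2 ∧ p₃ ≤ 2 ∧ p₁ + p₂ + p₃ = 3 ∧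
          ∃ (a : ExtC V) (d : ExtD V) (b : ExtC V),
            a ∈ hodgeComp V W 2 p₁ ∧ d ∈ dualHodgeComp V W p₂ ∧ b ∈ hodgeComp V W 2 p₃ ∧
            t = a ⊗ₜ[ℂ] (d ⊗ₜ[ℂ] b)} →
      y = 0 := by
  intro y hy hyH
  obtain ⟨e, u, c, E, hrec, hu, he, hE⟩ := setup_lemma V n hn hdim φ lam hinj hroot hgal W hWinv
    hWsup hWinf
  let ev : Fin (2 * n) → (DualVC V →ₗ[ℂ] ℂ) := fun i => Module.Dual.eval ℂ (ℂ ⊗[ℚ] V) (e i)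
  have hev : ∀ i (f : DualVC V), ev i f = f (e i) := fun i f => rfl
  have hrec' : ∀ f : DualVC V, ∑ i, (c i * ev i f) • u i = f := by
    intro f
    apply LinearMap.ext
    intro x
    conv_rhs => rw [← hrec x]
    rw [LinearMap.sum_apply, map_sum]
    refine Finset.sum_congr rfl fun i _ => ?_
    rw [LinearMap.smul_apply, map_smul, hev, smul_eq_mul, smul_eq_mul]
    ring
  let Φ : (Fin 6 → Fin (2 * n)) → (ExtC V ⊗[ℂ] (ExtD V ⊗[ℂ] ExtC V)) →ₗ[ℂ] ℂ := fun i =>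
    trip (DD (u (i 0)) (u (i 1))) (DD (ev (i 2)) (ev (i 3))) (DD (u (i 4)) (u (i 5)))
  -- rationality
  have hSu : ∀ (k l : Fin 6) (a : ExteriorAlgebra ℚ V), a ∈ ⋀[ℚ]^2 V →
      (fun i : Fin 6 → Fin (2 * n) => DD (u (i k)) (u (i l)) (thetaA V a)) ∈ SS (2 * n) lam := by
    exact fun k l a ha => hSu_aux V (2 * n) lam u hu k l a ha
  have hSe : ∀ (k l : Fin 6) (d : ExtD V), d ∈ ratDual2 V →
      (fun i : Fin 6 → Fin (2 * n) => DD (ev (i k)) (ev (i l)) d) ∈ SS (2 * n) lam := by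
    intro k l d hd
    refine SS_qsmul (2 * n) lam _ (fun i => (DD (ev (i k)) (ev (i l))).toAddMonoidHom) ?_ _ hd
    rintro _ ⟨v, hv, rfl⟩
    change (fun i : Fin 6 → Fin (2 * n) => DD (ev (i k)) (ev (i l)) (ExteriorAlgebra.ιMulti ℂ 2 v))
      ∈ SS (2 * n) lam
    simp only [DD_apply, hev]
    obtain ⟨P, hP⟩ := he (v 0) (hv 0)
    obtain ⟨Q, hQ⟩ := he (v 1) (hv 1)
    simp only [hP, hQ]
    exact (SS _ lam).sub_mem ((SS _ lam).mul_mem (SS_poly _ lam k P) (SS_poly _ lam l Q))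
      ((SS _ lam).mul_mem (SS_poly _ lam l P) (SS_poly _ lam k Q))
  have hS : (fun i => Φ i y) ∈ SS (2 * n) lam := by
    refine SS_qsmul (2 * n) lam _ (fun i => (Φ i).toAddMonoidHom) ?_ y hy
    rintro _ ⟨a, b, d, ha, hb, hd, rfl⟩
    change (fun i => Φ i (thetaA V a ⊗ₜ[ℂ] (d ⊗ₜ[ℂ] thetaA V b))) ∈ SS (2 * n) lam
    simp only [Φ, trip_tmul]
    exact (SS _ lam).mul_mem (hSu 0 1 a ha) ((SS _ lam).mul_mem (hSe 2 3 d hd) (hSu 4 5 b hb))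
  -- Hodge types
  have hHu : ∀ (p : ℕ) (a : ExtC V), p ≤ 2 → a ∈ hodgeComp V W 2 p → ∀ i j,
      E i + E j ≠ p → DD (u i) (u j) a = 0 := by
    intro p a hp ha i j hij
    unfold hodgeComp at ha
    induction ha using Submodule.span_induction with
    | zero => simp
    | add x y _ _ hx hy => rw [map_add, hx, hy, add_zero]
    | smul q x _ hx => rw [map_smul, hx, smul_zero]
    | mem x hx =>
      obtain ⟨v, hv, rfl⟩ := hx
      have h0 := hv 0
      have h1 := hv 1
      rw [DD_apply]
      rcases hE i with ⟨e1, -, f1⟩ | ⟨e1, -, f1⟩ <;> rcases hE j with ⟨e2, -, f2⟩ | ⟨e2, -, f2⟩ <;>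
      rw [e1, e2] at hij <;> interval_cases p <;> simp at hij h0 h1 <;>
      simp [f1, f2, h0, h1]
  have hHe : ∀ (p : ℕ) (a : ExtD V), p ≤ 2 → a ∈ dualHodgeComp V W p → ∀ i j,
      2 - (E i + E j) ≠ p → DD (ev i) (ev j) a = 0 := by
    intro p a hp ha i j hij
    unfold dualHodgeComp at ha
    induction ha using Submodule.span_induction with
    | zero => simp
    | add x y _ _ hx hy => rw [map_add, hx, hy, add_zero]
    | smul q x _ hx => rw [map_smul, hx, smul_zero]
    | mem x hx =>
      obtain ⟨v, hv, rfl⟩ := hx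
      have h0 := hv 0
      have h1 := hv 1
      rw [DD_apply]
      simp only [hev]
      rcases hE i with ⟨e1, f1, -⟩ | ⟨e1, f1, -⟩ <;> rcases hE j with ⟨e2, f2, -⟩ | ⟨e2, f2, -⟩ <;>
      rw [e1, e2] at hij <;> interval_cases p <;> simp at hij h0 h1 <;>
      simp [f1, f2, h0, h1]
  have hH : ∀ i : Fin 6 → Fin (2 * n),
      E (i 0) + E (i 1) - E (i 2) - E (i 3) + E (i 4) + E (i 5) ≠ 1 → Φ i y = 0 := by
    intro i hi
    clear hS hy
    induction hyH using Submodule.span_induction with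
    | zero => simp
    | add x y _ _ hx hy => rw [map_add, hx, hy, add_zero]
    | smul q x _ hx => rw [map_smul, hx, smul_zero]
    | mem x hx =>
      obtain ⟨p₁, p₂, p₃, h1, h2, h3, hs, a, d, b, ha, hd, hb, rfl⟩ := hx
      simp only [Φ, trip_tmul]
      by_cases g1 : E (i 0) + E (i 1) = p₁
      · by_cases g2 : 2 - (E (i 2) + E (i 3)) = p₂
        · have g3 : E (i 4) + E (i 5) ≠ p₃ := by omega
          rw [hHu p₃ b h3 hb _ _ g3]; simp
        · rw [hHe p₂ d h2 hd _ _ g2]; simp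
      · rw [hHu p₁ a h1 ha _ _ g1]; simp
  have hzero : ∀ i, Φ i y = 0 := by
    intro i
    have : ∃ τ : Equiv.Perm (Fin (2 * n)), E (τ (i 0)) + E (τ (i 1)) - E (τ (i 2)) - E (τ (i 3))
      + E (τ (i 4)) + E (τ (i 5)) ≠ 1 := by
      by_contra hc
      push Not at hc
      exact comb (2 * n) (by omega) E (fun i => (hE i).elim (fun h => Or.inr h.1)
        (fun h => Or.inl h.1)) i hc
    obtain ⟨τ, hτ⟩ := this
    have hz : Φ (fun k => τ (i k)) y = 0 := hH (fun k => τ (i k)) hτ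
    exact SS_gal (2 * n) lam hgal (fun i => Φ i y) hS i τ hz
  -- reconstruction
  have hRu : ∀ a ∈ ⋀[ℚ]^2 V, RR u e c (thetaA V a) = (2 : ℂ) • thetaA V a :=
    fun a ha => hRu_aux V (2 * n) u e c hrec a ha
  have hRe : ∀ d ∈ ratDual2 V, RR ev u c d = (2 : ℂ) • d := by
    intro d hd
    refine eq_of_span _ (RR ev u c).toAddMonoidHom
      ((2 : ℂ) • LinearMap.id : ExtD V →ₗ[ℂ] ExtD V).toAddMonoidHom ?_ _ hd
    rintro _ ⟨v, -, rfl⟩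
    exact RR_iM ev u c hrec' _
  have hR : TensorProduct.map (RR u e c) (TensorProduct.map (RR ev u c) (RR u e c)) y =
      (8 : ℂ) • y := by
    refine eq_of_span _
      (TensorProduct.map (RR u e c) (TensorProduct.map (RR ev u c) (RR u e c))).toAddMonoidHom
      ((8 : ℂ) • LinearMap.id : (ExtC V ⊗[ℂ] (ExtD V ⊗[ℂ] ExtC V)) →ₗ[ℂ] _).toAddMonoidHom
      ?_ y hy
    rintro _ ⟨a, b, d, ha, hb, hd, rfl⟩
    change TensorProduct.map (RR u e c) (TensorProduct.map (RR ev u c) (RR u e c))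
      (thetaA V a ⊗ₜ[ℂ] (d ⊗ₜ[ℂ] thetaA V b)) =
      (8 : ℂ) • (thetaA V a ⊗ₜ[ℂ] (d ⊗ₜ[ℂ] thetaA V b))
    rw [TensorProduct.map_tmul, TensorProduct.map_tmul, hRu a ha, hRe d hd, hRu b hb,
      TensorProduct.smul_tmul_smul, TensorProduct.smul_tmul_smul]
    norm_num
  have hR0 : TensorProduct.map (RR u e c) (TensorProduct.map (RR ev u c) (RR u e c)) y = 0 := by
    rw [map3 _ _ _ _ _ _ _ _ _ _ (RR_apply u e c) (RR_apply ev u c) (RR_apply u e c) y]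
    refine Finset.sum_eq_zero fun x _ => Finset.sum_eq_zero fun z _ =>
      Finset.sum_eq_zero fun w _ => ?_
    have := hzero ![x.1, x.2, z.1, z.2, w.1, w.2]
    change trip (DD (u x.1) (u x.2)) (DD (ev z.1) (ev z.2)) (DD (u w.1) (u w.2)) y = 0 at this
    rw [this, mul_zero, zero_smul]
  rw [hR0] at hR
  exact (smul_eq_zero.1 hR.symm).resolve_left (by norm_num)

end VoisinPaper
end
end

section
/- There exist integers a, b, c such that the map sending each triple ({i,j}, {k,l}, {r,s}) of 2-element subsets of {1,…,2n} to the complex number (λ_i λ_j)^a · (λ_k λ_l)^b · (λ_r λ_s)^c is injective on the set of such triples. -/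
open scoped TensorProduct

noncomputable section

namespace VoisinPaper

theorem aux_ne {ι L : Type*} [DecidableEq ι] [Field L] (x : ι → L)
    (hx : Function.Injective x)
    (h : ∀ τ : Equiv.Perm ι, ∃ σ : L ≃+* L, ∀ i, σ (x i) = x (τ i))
    (hex : ∀ i : ι, ∃ j, j ≠ i) (i : ι) : x i ≠ 0 := by
  intro h0
  obtain ⟨j, hj⟩ := hex i
  obtain ⟨σ, hσ⟩ := h (Equiv.swap i j)
  have := hσ i
  rw [h0, map_zero, Equiv.swap_apply_left, ← h0] at this
  exact hj (hx this).symm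

theorem aux_sq {ι L : Type*} [DecidableEq ι] [Field L] (x : ι → L)
    (h : ∀ τ : Equiv.Perm ι, ∃ σ : L ≃+* L, ∀ i, σ (x i) = x (τ i))
    (h0 : ∀ i, x i ≠ 0) {i j k l : ι} (hij : i ≠ j) (hik : i ≠ k) (hil : i ≠ l)
    (hjk : j ≠ k) (hjl : j ≠ l) (hkl : k ≠ l)
    (d : ℕ) (hd : 0 < d) (hu : (x i / x j) ^ d = 1) : x k ^ 2 = x l ^ 2 := by
  have hprim := IsPrimitiveRoot.orderOf (x i / x j)
  have hpos : 0 < orderOf (x i / x j) :=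
    orderOf_pos_iff.2 (isOfFinOrder_iff_pow_eq_one.2 ⟨d, hd, hu⟩)
  obtain ⟨σ', hσ'⟩ := h (Equiv.swap i k * Equiv.swap j l)
  have e1 : σ' (x i / x j) = x k / x l := by
    rw [map_div₀, hσ', hσ']
    congr 2
    · simp [Equiv.Perm.mul_apply, Equiv.swap_apply_of_ne_of_ne hij hil]
    · simp [Equiv.Perm.mul_apply, Equiv.swap_apply_of_ne_of_ne hil.symm hkl.symm]
  have hv : (x k / x l) ^ orderOf (x i / x j) = 1 := by
    rw [← e1, ← map_pow, pow_orderOf_eq_one, map_one]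
  have : NeZero (orderOf (x i / x j)) := ⟨hpos.ne'⟩
  obtain ⟨e, -, he⟩ := hprim.eq_pow_of_pow_eq_one hv
  obtain ⟨σ, hσ⟩ := h (Equiv.swap i j)
  have e2 : σ (x i / x j) = (x i / x j)⁻¹ := by
    rw [map_div₀, hσ, hσ, Equiv.swap_apply_left, Equiv.swap_apply_right, inv_div]
  have e3 : σ (x k / x l) = x k / x l := by
    rw [map_div₀, hσ, hσ, Equiv.swap_apply_of_ne_of_ne hik.symm hjk.symm,
      Equiv.swap_apply_of_ne_of_ne hil.symm hjl.symm]
  have e4 : x k / x l = (x k / x l)⁻¹ := by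
    rw [← he, ← inv_pow, ← e2, ← map_pow, he, e3]
  have hk := h0 k
  have hl := h0 l
  field_simp at e4
  exact e4

theorem aux_const {ι L : Type*} [Fintype ι] [DecidableEq ι] [Field L] (x : ι → L)
    (hx : Function.Injective x)
    (h : ∀ τ : Equiv.Perm ι, ∃ σ : L ≃+* L, ∀ i, σ (x i) = x (τ i))
    (hcard : 5 ≤ Fintype.card ι) (h0 : ∀ i, x i ≠ 0) (m : ι → ℤ)
    (hm : ∏ i, x i ^ m i = 1) (i j : ι) : m i = m j := by
  by_contra hne
  have hij : i ≠ j := fun e => hne (by rw [e])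
  obtain ⟨σ, hσ⟩ := h (Equiv.swap i j)
  have h1 : ∏ t, x (Equiv.swap i j t) ^ m t = 1 := by
    have := congrArg σ hm
    rw [map_prod, map_one] at this
    simpa [map_zpow₀, hσ] using this
  have h2 : ∏ t, (x t ^ m t / x (Equiv.swap i j t) ^ m t) = 1 := by
    rw [Finset.prod_div_distrib, hm, h1, div_one]
  have h3 : (x i / x j) ^ (m i - m j) = 1 := by
    rw [← h2, ← Finset.prod_subset (Finset.subset_univ {i, j}), Finset.prod_pair hij]
    · have hi := h0 i
      have hj := h0 j
      rw [Equiv.swap_apply_left, Equiv.swap_apply_right, zpow_sub₀ (div_ne_zero hi hj),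
        div_zpow, div_zpow]
      field_simp
    · intro t _ ht
      simp only [Finset.mem_insert, Finset.mem_singleton, not_or] at ht
      rw [Equiv.swap_apply_of_ne_of_ne ht.1 ht.2, div_self (zpow_ne_zero _ (h0 t))]
  have h4 : (x i / x j) ^ (m i - m j).natAbs = 1 := by
    rcases Int.natAbs_eq (m i - m j) with hh | hh
    · rw [hh, zpow_natCast] at h3
      exact h3
    · rw [hh, zpow_neg, zpow_natCast, inv_eq_one] at h3
      exact h3
  have hd : 0 < (m i - m j).natAbs := Int.natAbs_pos.2 (sub_ne_zero.2 hne)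
  have hc : 2 < (({i, j} : Finset ι)ᶜ).card := by
    rw [Finset.card_compl, Finset.card_pair hij]; omega
  obtain ⟨k, l, r, hk, hl, hr, hkl, hkr, hlr⟩ := Finset.two_lt_card_iff.1 hc
  simp only [Finset.mem_compl, Finset.mem_insert, Finset.mem_singleton, not_or] at hk hl hr
  have q1 := aux_sq x h h0 hij (Ne.symm hk.1) (Ne.symm hl.1) (Ne.symm hk.2) (Ne.symm hl.2) hkl _ hd h4
  have q2 := aux_sq x h h0 hij (Ne.symm hk.1) (Ne.symm hr.1) (Ne.symm hk.2) (Ne.symm hr.2) hkr _ hd h4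
  have r1 := (sq_eq_sq_iff_eq_or_eq_neg.1 q1).resolve_left (fun e => hkl (hx e))
  have r2 := (sq_eq_sq_iff_eq_or_eq_neg.1 q2).resolve_left (fun e => hkr (hx e))
  exact hlr (hx (neg_injective (r1.symm.trans r2)))

/-- integer indicator -/
def ind {ι : Type*} [DecidableEq ι] (s : Finset ι) (i : ι) : ℤ := if i ∈ s then 1 else 0

theorem ind_sum {ι : Type*} [Fintype ι] [DecidableEq ι] (s : Finset ι) :
    ∑ i, ind s i = s.card := by
  simp [ind]

theorem ind_prod {ι L : Type*} [Fintype ι] [DecidableEq ι] [Field L] (x : ι → L)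
    (s : Finset ι) (a : ℤ) : (∏ i ∈ s, x i) ^ a = ∏ i, x i ^ (a * ind s i) := by
  rw [← Finset.prod_zpow, ← Finset.prod_subset (Finset.subset_univ s)]
  · exact Finset.prod_congr rfl fun i hi => by simp [ind, hi]
  · intro i _ hi
    simp [ind, hi]

theorem ind_val {ι : Type*} [DecidableEq ι] (s : Finset ι) (i : ι) :
    (i ∈ s ↔ ind s i = 1) ∧ 0 ≤ ind s i ∧ ind s i ≤ 1 := by
  by_cases hi : i ∈ s <;> simp [ind, hi]

theorem ind_key {ι : Type*} [DecidableEq ι] (s₁ t₁ u₁ s₂ t₂ u₂ : Finset ι) (i : ι)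
    (h : (1 * ind s₁ i + 3 * ind t₁ i + 9 * ind u₁ i) -
      (1 * ind s₂ i + 3 * ind t₂ i + 9 * ind u₂ i) = 0) :
    (i ∈ s₁ ↔ i ∈ s₂) ∧ (i ∈ t₁ ↔ i ∈ t₂) ∧ (i ∈ u₁ ↔ i ∈ u₂) := by
  have a₁ := ind_val s₁ i
  have b₁ := ind_val t₁ i
  have c₁ := ind_val u₁ i
  have a₂ := ind_val s₂ i
  have b₂ := ind_val t₂ i
  have c₂ := ind_val u₂ i
  rw [a₁.1, b₁.1, c₁.1, a₂.1, b₂.1, c₂.1]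
  omega

/-- For a monic rational polynomial of degree `2n` (`n ≥ 4`) with `2n` distinct
complex roots on which the Galois group of its splitting field acts as the full symmetric group,
there are integers `a, b, c` such that the map sending a triple `({i,j},{k,l},{r,s})` of
2-element subsets of the index set to `(λ_i λ_j)^a (λ_k λ_l)^b (λ_r λ_s)^c` is injective. -/
theorem exists_abc_injective_on_triples_of_pairs
    (n : ℕ) (hn : 4 ≤ n)
    (f : Polynomial ℚ) (hmonic : f.Monic) (hdeg : f.natDegree = 2 * n)
    (lam : Fin (2 * n) → ℂ) (hinj : Function.Injective lam)
    (hroot : ∀ i, Polynomial.aeval (lam i) f = 0)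
    (hgal : galoisActsFully (2 * n) lam) :
    ∃ a b c : ℤ,
      ∀ s₁ t₁ u₁ s₂ t₂ u₂ : Finset (Fin (2 * n)),
        s₁.card = 2 → t₁.card = 2 → u₁.card = 2 →
        s₂.card = 2 → t₂.card = 2 → u₂.card = 2 →
        (∏ i ∈ s₁, lam i) ^ a * (∏ i ∈ t₁, lam i) ^ b * (∏ i ∈ u₁, lam i) ^ c =
          (∏ i ∈ s₂, lam i) ^ a * (∏ i ∈ t₂, lam i) ^ b * (∏ i ∈ u₂, lam i) ^ c →
        s₁ = s₂ ∧ t₁ = t₂ ∧ u₁ = u₂ := by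
  have hcard : 5 ≤ Fintype.card (Fin (2 * n)) := by simp; omega
  set x : Fin (2 * n) → splittingFieldOfRoots (2 * n) lam :=
    fun i => ⟨lam i, root_mem_splittingFieldOfRoots (2 * n) lam i⟩ with hxdef
  have hx : Function.Injective x := fun i j e => hinj (congrArg Subtype.val e)
  have h : ∀ τ : Equiv.Perm (Fin (2 * n)), ∃ σ : splittingFieldOfRoots (2 * n) lam ≃+*
      splittingFieldOfRoots (2 * n) lam, ∀ i, σ (x i) = x (τ i) := by
    intro τ
    obtain ⟨σ, hσ⟩ := hgal τ
    exact ⟨σ.toRingEquiv, fun i => Subtype.ext (hσ i)⟩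
  have : Nontrivial (Fin (2 * n)) := Fintype.one_lt_card_iff_nontrivial.1 (by omega)
  have h0 := aux_ne x hx h (fun i => exists_ne i)
  refine ⟨1, 3, 9, ?_⟩
  intro s₁ t₁ u₁ s₂ t₂ u₂ hs₁ ht₁ hu₁ hs₂ ht₂ hu₂ heq
  have hl0 : ∀ i, lam i ≠ 0 := fun i e => h0 i (Subtype.ext e)
  simp only [ind_prod, ← Finset.prod_mul_distrib, ← zpow_add₀ (hl0 _)] at heq
  set m : Fin (2 * n) → ℤ := fun i => (1 * ind s₁ i + 3 * ind t₁ i + 9 * ind u₁ i) -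
    (1 * ind s₂ i + 3 * ind t₂ i + 9 * ind u₂ i) with hmdef
  have hm' : ∏ i, lam i ^ m i = 1 := by
    simp only [hmdef, zpow_sub₀ (hl0 _), Finset.prod_div_distrib]
    rw [heq]
    exact div_self (Finset.prod_ne_zero_iff.2 fun i _ => zpow_ne_zero _ (hl0 i))
  have hm : ∏ i, x i ^ m i = 1 := by
    apply Subtype.ext
    have hv := map_prod (splittingFieldOfRoots (2 * n) lam).val (fun i => x i ^ m i) Finset.univ
    simp only [map_zpow₀] at hv
    exact hv.trans hm'
  have hc := aux_const x hx h hcard h0 m hm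
  have hsum : ∑ i, m i = 0 := by
    simp only [hmdef, Finset.sum_sub_distrib, Finset.sum_add_distrib, ← Finset.mul_sum, ind_sum,
      hs₁, ht₁, hu₁, hs₂, ht₂, hu₂]
    norm_num
  have hz : ∀ i, m i = 0 := by
    intro i
    rw [Finset.sum_congr rfl (fun j _ => hc j i), Finset.sum_const, smul_eq_zero] at hsum
    refine hsum.resolve_left ?_
    rw [Finset.card_univ]; omega
  have key : ∀ i, (i ∈ s₁ ↔ i ∈ s₂) ∧ (i ∈ t₁ ↔ i ∈ t₂) ∧ (i ∈ u₁ ↔ i ∈ u₂) := by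
    intro i
    have := hz i
    exact ind_key _ _ _ _ _ _ i this
  exact ⟨Finset.ext fun i => (key i).1, Finset.ext fun i => (key i).2.1,
    Finset.ext fun i => (key i).2.2⟩

end VoisinPaper
end
end
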